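/- The reference trajectory eventually dominates the error budget (Lemma thm:traj_large). There exists ε⁰ > 0, depending only on q, p, r, and ε_R, such that for every ε_L ∈ (0, ε⁰) and every θ ∈ (0, ε_L): for every admissible n and every error–erasure pattern for which t_min exists, the largest element t_max of T with t_max ≤ n(1 − ε_L) exists, satisfies t_max ≥ t_min, and (t_max − Λ_{t_max})·p̂_{t_max} ≥ n·p. -/

import Mathlib

/-- The q-ary entropy function: `H_q(x) = x·log_q(q−1) − x·log_q(x) − (1−x)·log_q(1−x)`.
With the convention `Real.logb b 0 = 0` this gives `H_q(0) = 0` and `H_q(1) = log_q(q−1)`. -/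
noncomputable def Hq (q : ℕ) (x : ℝ) : ℝ :=
  x * Real.logb q ((q : ℝ) - 1) - x * Real.logb q x - (1 - x) * Real.logb q (1 - x)

/-- `α(p̄) = 1 − (2q/(q−1))(p − p̄) − (q/(q−1))r`. -/
noncomputable def alphaEE (q : ℕ) (p r pb : ℝ) : ℝ :=
  1 - (2 * (q : ℝ) / ((q : ℝ) - 1)) * (p - pb) - ((q : ℝ) / ((q : ℝ) - 1)) * r

/-- `C₀(q,p,r) = min_{p̄ ∈ [0,p]} α(p̄)·(1 − H_q(p̄/α(p̄)))` (the minimum is attained,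
so it equals the infimum). -/
noncomputable def C0 (q : ℕ) (p r : ℝ) : ℝ :=
  sInf ((fun pb => alphaEE q p r pb * (1 - Hq q (pb / alphaEE q p r pb))) '' Set.Icc 0 p)

/-- An error–erasure pattern for blocklength `n = s·K` with feedback resolution
`θ = 1/K = s/n`, error fraction `p` and erasure fraction `r`. The time instants of
the set `T = {θn, 2θn, …, (1−θ)n}` are `t = j·s` for `j = 1,…,K−1`; `lam j` is the
cumulative number of erasures among the first `j·s` positions and `E j` the cumulative
number of symbol errors among the first `j·s − lam j` unerased positions. -/
structure EEPattern (p r : ℝ) (n s K : ℕ) where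
  lam : ℕ → ℕ
  E : ℕ → ℕ
  mono_lam : ∀ j : ℕ, 1 ≤ j → j + 1 ≤ K - 1 → lam j ≤ lam (j + 1)
  mono_E : ∀ j : ℕ, 1 ≤ j → j + 1 ≤ K - 1 → E j ≤ E (j + 1)
  lam_le : ∀ j : ℕ, 1 ≤ j → j ≤ K - 1 → lam j ≤ j * s ∧ (lam j : ℝ) ≤ r * n
  E_le : ∀ j : ℕ, 1 ≤ j → j ≤ K - 1 → E j + lam j ≤ j * s ∧ (E j : ℝ) ≤ p * n
  incr : ∀ j : ℕ, 2 ≤ j → j ≤ K - 1 →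
    (lam j - lam (j - 1)) + (E j - E (j - 1)) ≤ s

namespace EEPattern

variable {p r : ℝ} {n s K : ℕ}

/-- The adversary's error trajectory `p_t = E_t/(t − Λ_t)` at time `t = j·s`. -/
noncomputable def pt (P : EEPattern p r n s K) (j : ℕ) : ℝ :=
  (P.E j : ℝ) / (((j * s : ℕ) : ℝ) - (P.lam j : ℝ))

end EEPattern

/-- The set of indices `j` (times `t = j·s ∈ T`) at which `t − Λ_t > n(R + ε_L)`;
`t_min` is its least element. -/
def tminSet (R εL : ℝ) {p r : ℝ} {n s K : ℕ} (P : EEPattern p r n s K) : Set ℕ :=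
  {j : ℕ | 1 ≤ j ∧ j ≤ K - 1 ∧ (n : ℝ) * (R + εL) < ((j * s : ℕ) : ℝ) - (P.lam j : ℝ)}

/-- `phat` is a reference trajectory for the pattern `P` (relative to `jmin = t_min/s`):
for every time `t = j·s ∈ T` with `t ≥ t_min`, `p̂_t ∈ [0,(q−1)/q]` and
`(t − Λ_t)(1 − H_q(p̂_t)) = n(R + ε_L)`. -/
def IsRefTraj (q : ℕ) (R εL : ℝ) {p r : ℝ} {n s K : ℕ}
    (P : EEPattern p r n s K) (jmin : ℕ) (phat : ℕ → ℝ) : Prop :=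
  ∀ j : ℕ, jmin ≤ j → j ≤ K - 1 →
    phat j ∈ Set.Icc (0 : ℝ) (((q : ℝ) - 1) / q) ∧
    (((j * s : ℕ) : ℝ) - (P.lam j : ℝ)) * (1 - Hq q (phat j)) = (n : ℝ) * (R + εL)

theorem Hq_eq_qaryEntropy_div_log (q : ℕ) (x : ℝ) :
    Hq q x = Real.qaryEntropy q x / Real.log q := by
  simp only [Hq, Real.qaryEntropy, Real.binEntropy, Real.logb, Real.log_inv]
  push_cast
  ring

theorem continuous_Hq (q : ℕ) : Continuous (Hq q) := by
  have h : Hq q = fun x => Real.qaryEntropy q x / Real.log q :=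
    funext (Hq_eq_qaryEntropy_div_log q)
  rw [h]
  exact Real.qaryEntropy_continuous.div_const _

theorem monotoneOn_Hq {q : ℕ} (hq : 2 ≤ q) :
    MonotoneOn (Hq q) (Set.Icc 0 (((q : ℝ) - 1) / q)) := by
  have hq0 : (q : ℝ) ≠ 0 := by positivity
  have hc : ((q : ℝ) - 1) / q = 1 - 1 / q := by field_simp
  rw [hc]
  intro x hx y hy hxy
  rw [Hq_eq_qaryEntropy_div_log, Hq_eq_qaryEntropy_div_log]
  exact div_le_div_of_nonneg_right
    ((Real.qaryEntropy_strictMonoOn hq).monotoneOn hx hy hxy) (Real.log_natCast_nonneg q)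

theorem Hq_zero (q : ℕ) : Hq q 0 = 0 := by simp [Hq]

theorem Hq_sub_one_div_self {q : ℕ} (hq : 2 ≤ q) : Hq q (((q : ℝ) - 1) / q) = 1 := by
  have hq' : (2 : ℝ) ≤ q := by exact_mod_cast hq
  have hq0 : (q : ℝ) ≠ 0 := by positivity
  have hq1 : (q : ℝ) - 1 ≠ 0 := by linarith
  have hlog : Real.log q ≠ 0 := (Real.log_pos (by linarith)).ne'
  have hc : 1 - ((q : ℝ) - 1) / q = 1 / q := by field_simp; ring
  rw [Hq, hc, Real.logb, Real.logb, Real.logb, Real.log_div hq1 hq0, Real.log_div one_ne_zero hq0,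
    Real.log_one]
  field_simp
  ring

theorem Hq_mem_Icc {q : ℕ} (hq : 2 ≤ q) {x : ℝ}
    (hx : x ∈ Set.Icc 0 (((q : ℝ) - 1) / q)) : Hq q x ∈ Set.Icc 0 1 := by
  have hc := hx.1.trans hx.2
  constructor
  · rw [← Hq_zero q]
    exact monotoneOn_Hq hq ⟨le_rfl, hc⟩ hx hx.1
  · rw [← Hq_sub_one_div_self hq]
    exact monotoneOn_Hq hq hx ⟨hc, le_rfl⟩ hx.2

/-- The perspective `y ↦ y·(1 − H_q(p/y))` is increasing where `p/y ≤ (q−1)/q`. -/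
theorem mul_one_sub_Hq_div_le {q : ℕ} (hq : 2 ≤ q) {p a b : ℝ} (hp : 0 ≤ p) (ha : 0 < a)
    (hab : a ≤ b) (hpa : p / a ≤ ((q : ℝ) - 1) / q) :
    a * (1 - Hq q (p / a)) ≤ b * (1 - Hq q (p / b)) := by
  have hle : p / b ≤ p / a := div_le_div_of_nonneg_left hp ha hab
  have hb : 0 ≤ p / b := div_nonneg hp (ha.le.trans hab)
  have hmem : p / a ∈ Set.Icc 0 (((q : ℝ) - 1) / q) := ⟨hb.trans hle, hpa⟩
  have hmono := monotoneOn_Hq hq ⟨hb, hle.trans hpa⟩ hmem hle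
  have := (Hq_mem_Icc hq hmem).2
  exact mul_le_mul hab (by linarith) (by linarith) (ha.le.trans hab)

theorem alphaEE_pos_and_div_le {q : ℕ} (hq : 2 ≤ q) {p r pb : ℝ}
    (hpr : 2 * p + r < ((q : ℝ) - 1) / q) (hpb : 0 ≤ pb) :
    0 < alphaEE q p r pb ∧ pb / alphaEE q p r pb ≤ ((q : ℝ) - 1) / q := by
  have hq' : (2 : ℝ) ≤ q := by exact_mod_cast hq
  set c := ((q : ℝ) - 1) / q with hc
  have hc0 : 0 < c := div_pos (by linarith) (by linarith)
  have hα : alphaEE q p r pb = 1 - (2 * p + r) / c + 2 * (pb / c) := by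
    have : (q : ℝ) - 1 ≠ 0 := by linarith
    rw [alphaEE, hc]
    field_simp
    ring
  have h1 : (2 * p + r) / c < 1 := (div_lt_one hc0).2 hpr
  have h2 : 0 ≤ pb / c := div_nonneg hpb hc0.le
  have hpos : 0 < alphaEE q p r pb := by rw [hα]; linarith
  refine ⟨hpos, ?_⟩
  rw [div_le_comm₀ hpos hc0, hα]
  linarith

theorem C0_le_mul_one_sub_Hq {q : ℕ} (hq : 2 ≤ q) {p r : ℝ} (hp : 0 ≤ p) (hr : 0 ≤ r)
    (hpr : 2 * p + r < ((q : ℝ) - 1) / q) :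
    C0 q p r ≤ (1 - r) * (1 - Hq q (p / (1 - r))) := by
  have hq' : (2 : ℝ) ≤ q := by exact_mod_cast hq
  have hbdd : BddBelow ((fun pb => alphaEE q p r pb * (1 - Hq q (pb / alphaEE q p r pb))) ''
      Set.Icc 0 p) := by
    refine ⟨0, ?_⟩
    rintro _ ⟨pb, hpb, rfl⟩
    obtain ⟨hα, hdiv⟩ := alphaEE_pos_and_div_le hq hpr hpb.1
    have := (Hq_mem_Icc hq ⟨div_nonneg hpb.1 hα.le, hdiv⟩).2
    exact mul_nonneg hα.le (by linarith)
  obtain ⟨hα, hdiv⟩ := alphaEE_pos_and_div_le hq hpr hp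
  have hαr : alphaEE q p r p ≤ 1 - r := by
    have h1 : 1 ≤ (q : ℝ) / ((q : ℝ) - 1) := (one_le_div (by linarith)).2 (by linarith)
    have h2 := mul_le_mul_of_nonneg_right h1 hr
    rw [alphaEE, sub_self, mul_zero]
    linarith
  exact (csInf_le hbdd ⟨p, ⟨hp, le_rfl⟩, rfl⟩).trans (mul_one_sub_Hq_div_le hq hp hα hαr hdiv)

/-- For small slack `ε`, the perspective function at `1 − r − 2ε` still exceeds the rate. -/
theorem exists_forall_rate_lt_mul_one_sub_Hq {q : ℕ} (hq : 2 ≤ q) {p r : ℝ} (hp : 0 ≤ p)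
    (hr : 0 ≤ r) (hpr : 2 * p + r < ((q : ℝ) - 1) / q) {δ : ℝ} (hδ : 0 < δ) :
    ∃ ε0 : ℝ, 0 < ε0 ∧ ∀ ε : ℝ, 0 < ε → ε < ε0 →
      0 < 1 - r - 2 * ε ∧ p / (1 - r - 2 * ε) ≤ ((q : ℝ) - 1) / q ∧
      C0 q p r - δ + ε < (1 - r - 2 * ε) * (1 - Hq q (p / (1 - r - 2 * ε))) := by
  have hq' : (2 : ℝ) ≤ q := by exact_mod_cast hq
  have hc1 : ((q : ℝ) - 1) / q < 1 := (div_lt_one (by linarith)).2 (by linarith)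
  have hr1 : 0 < 1 - r - 2 * 0 := by linarith
  have hpdiv : p / (1 - r - 2 * 0) < ((q : ℝ) - 1) / q := by
    set c := ((q : ℝ) - 1) / q
    rw [div_lt_iff₀ hr1]
    nlinarith
  have hcy : ContinuousAt (fun ε : ℝ => 1 - r - 2 * ε) 0 := by fun_prop
  have hcd : ContinuousAt (fun ε : ℝ => p / (1 - r - 2 * ε)) 0 :=
    continuousAt_const.div hcy hr1.ne'
  have hcF : ContinuousAt
      (fun ε : ℝ => (1 - r - 2 * ε) * (1 - Hq q (p / (1 - r - 2 * ε)))) 0 :=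
    hcy.mul (continuousAt_const.sub ((continuous_Hq q).continuousAt.comp hcd))
  have hcR : ContinuousAt (fun ε : ℝ => C0 q p r - δ + ε) 0 := by fun_prop
  have hF : C0 q p r - δ + 0 < (1 - r - 2 * 0) * (1 - Hq q (p / (1 - r - 2 * 0))) := by
    have := C0_le_mul_one_sub_Hq hq hp hr hpr
    simp only [mul_zero, sub_zero, add_zero]
    linarith
  have hev := (hcy.eventually_const_lt hr1).and
    ((hcd.eventually_lt_const hpdiv).and (hcR.eventually_lt hcF hF))
  obtain ⟨ε0, hε0, hball⟩ := Metric.eventually_nhds_iff.1 hev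
  refine ⟨ε0, hε0, fun ε h0 h1 => ?_⟩
  obtain ⟨ha, hb, hc⟩ := hball (y := ε) (by rwa [Real.dist_eq, sub_zero, abs_of_pos h0])
  exact ⟨ha, hb.le, hc⟩

/-- The last time of the grid `{s, 2s, …, (K−1)s}` before `sK(1 − ε)` exists and, when the mesh is
finer than `ε`, lies within `2ε·sK` of the end. -/
theorem exists_isGreatest_grid {s K : ℕ} {n ε : ℝ} (hs : 0 < s) (hn : n = s * K)
    (hsε : (s : ℝ) < ε * n) (hε : ε < 1 / 2) :
    ∃ j : ℕ, IsGreatest {j : ℕ | 1 ≤ j ∧ j ≤ K - 1 ∧ ((j * s : ℕ) : ℝ) ≤ n * (1 - ε)} j ∧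
      n * (1 - 2 * ε) < ((j * s : ℕ) : ℝ) := by
  have hs' : (0 : ℝ) < s := by exact_mod_cast hs
  have hn0 : 0 < n := by
    rcases (show 0 ≤ n by rw [hn]; positivity).eq_or_lt with h | h
    · rw [← h] at hsε; linarith
    · exact h
  have h2s : 2 * (s : ℝ) < n := by nlinarith
  have hK : 2 < K := by
    have : (2 : ℝ) < K := by
      rw [hn] at h2s
      nlinarith
    exact_mod_cast this
  set S := {j : ℕ | 1 ≤ j ∧ j ≤ K - 1 ∧ ((j * s : ℕ) : ℝ) ≤ n * (1 - ε)} with hS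
  have hne : S.Nonempty := ⟨1, le_rfl, by omega, by push_cast; nlinarith⟩
  have hbdd : BddAbove S := ⟨K - 1, fun j hj => hj.2.1⟩
  have hmem : sSup S ∈ S := Nat.sSup_mem hne hbdd
  refine ⟨sSup S, ⟨hmem, fun j hj => le_csSup hbdd hj⟩, ?_⟩
  obtain ⟨h1, h2, -⟩ := hmem
  by_contra! hle
  push_cast at hle
  have hnext : ((sSup S : ℕ) + 1 : ℝ) * s ≤ n * (1 - ε) := by nlinarith
  have hlt : sSup S + 1 < K := by
    have : ((sSup S : ℕ) + 1 : ℝ) < K := by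
      by_contra! h
      have := mul_le_mul_of_nonneg_right h hs'.le
      nlinarith
    exact_mod_cast this
  have : sSup S + 1 ∈ S := ⟨by omega, by omega, by push_cast; exact hnext⟩
  have := le_csSup hbdd this
  omega

/-- The reference trajectory eventually dominates the error budget
(Lemma thm:traj_large). There exists ε⁰ > 0, depending only on q, p, r, ε_R, such that
for every ε_L ∈ (0, ε⁰) and every θ ∈ (0, ε_L): for every admissible n and every
error–erasure pattern for which t_min exists, the largest element t_max of T with
t_max ≤ n(1 − ε_L) exists, satisfies t_max ≥ t_min, and
(t_max − Λ_{t_max})·p̂_{t_max} ≥ n·p. -/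
theorem traj_eventually_large (q : ℕ) (hq : 2 ≤ q) (p r : ℝ)
    (hp : p ∈ Set.Icc (0 : ℝ) 1) (hr : r ∈ Set.Icc (0 : ℝ) 1)
    (hpr : 2 * p + r < ((q : ℝ) - 1) / q)
    (εR : ℝ) (hεR0 : 0 < εR) (hεR1 : εR < C0 q p r) :
    ∃ ε0 : ℝ, 0 < ε0 ∧ ∀ εL : ℝ, 0 < εL → εL < ε0 →
      ∀ (θ : ℝ) (n s K : ℕ), 0 < θ → θ < 1 → 0 < s →
        (s : ℝ) = θ * n → (K : ℝ) = 1 / θ → θ < εL →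
      ∀ P : EEPattern p r n s K, ∀ jmin : ℕ,
        IsLeast (tminSet (C0 q p r - εR) εL P) jmin →
      ∀ phat : ℕ → ℝ, IsRefTraj q (C0 q p r - εR) εL P jmin phat →
      ∃ jmax : ℕ,
        IsGreatest {j : ℕ | 1 ≤ j ∧ j ≤ K - 1 ∧ ((j * s : ℕ) : ℝ) ≤ (n : ℝ) * (1 - εL)} jmax ∧
        jmin ≤ jmax ∧
        (n : ℝ) * p ≤ (((jmax * s : ℕ) : ℝ) - P.lam jmax) * phat jmax := by
  obtain ⟨ε1, hε1, hrate⟩ := exists_forall_rate_lt_mul_one_sub_Hq hq hp.1 hr.1 hpr hεR0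
  refine ⟨min ε1 (1 / 2), by positivity, ?_⟩
  intro εL hεL hεL1 θ n s K hθ hθ1 hs hsn hK hθε P jmin hjmin phat href
  obtain ⟨hy0, hpy0, hR⟩ := hrate εL hεL (hεL1.trans_le (min_le_left _ _))
  have hs' : (0 : ℝ) < s := by exact_mod_cast hs
  have hn0 : (0 : ℝ) < n := by
    rw [hsn] at hs'
    exact pos_of_mul_pos_right hs' hθ.le
  have hn : (n : ℝ) = s * K := by rw [hsn, hK]; field_simp
  have hsε : (s : ℝ) < εL * n := by rw [hsn]; exact mul_lt_mul_of_pos_right hθε hn0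
  obtain ⟨j, hj, hjlarge⟩ :=
    exists_isGreatest_grid hs hn hsε (hεL1.trans_le (min_le_right _ _))
  obtain ⟨hj1, hjK, -⟩ := hj.1
  set y0 := 1 - r - 2 * εL with hy0_def
  set Y : ℝ := ((j * s : ℕ) : ℝ) - P.lam j with hY
  have hYy : n * y0 ≤ Y := by
    have := (P.lam_le j hj1 hjK).2
    rw [hY, hy0_def]
    nlinarith
  have hu : p / y0 ∈ Set.Icc 0 (((q : ℝ) - 1) / q) := ⟨div_nonneg hp.1 hy0.le, hpy0⟩
  obtain ⟨hH0, hH1⟩ := Hq_mem_Icc hq hu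
  have hRy : C0 q p r - εR + εL < y0 := by nlinarith
  have hjmem : j ∈ tminSet (C0 q p r - εR) εL P :=
    ⟨hj1, hjK, (mul_lt_mul_of_pos_left hRy hn0).trans_le hYy⟩
  have hle : jmin ≤ j := hjmin.2 hjmem
  refine ⟨j, hj, hle, ?_⟩
  obtain ⟨hph, heq⟩ := href j hle hjK
  rw [← hY] at heq
  by_contra! hlt
  have hphle : phat j ≤ p / y0 := by
    rw [le_div_iff₀ hy0]
    have h1 : n * y0 * phat j ≤ Y * phat j := mul_le_mul_of_nonneg_right hYy hph.1
    have h2 : n * (phat j * y0) < n * p := by linarith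
    exact (lt_of_mul_lt_mul_left h2 hn0.le).le
  have hmono := monotoneOn_Hq hq hph hu hphle
  have h3 : n * y0 * (1 - Hq q (p / y0)) ≤ Y * (1 - Hq q (phat j)) :=
    mul_le_mul hYy (by linarith) (by linarith) ((mul_nonneg hn0.le hy0.le).trans hYy)
  have h4 := mul_lt_mul_of_pos_left hR hn0
  linarith
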